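/- Let S' be an additive submonoid of ℕ. Then the set of additive submonoids S of ℕ such that S ≤ S', the pair (S, S') is equi-gcd, and every additive submonoid T with S ≤ T ≤ S' is an intersection of radicals of S in S' (i.e. there exists a set A ⊆ ℕ with (T : Set ℕ) = {t ∈ ℕ : t ∈ S' ∧ ∀ n ∈ A, n * t ∈ S}), is finite. -/

import Mathlib

/-- The pair `(S, S')` is equi-gcd: a natural number divides every element of `S`
iff it divides every element of `S'`. -/
def EquiGcd (S S' : AddSubmonoid ℕ) : Prop :=
  ∀ d : ℕ, (∀ x ∈ S, d ∣ x) ↔ (∀ x ∈ S', d ∣ x)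

/-- The gap set `G(S'/S) = S' \ S`. -/
def gapSet (S S' : AddSubmonoid ℕ) : Set ℕ := (S' : Set ℕ) \ (S : Set ℕ)

/-- The sporadic set `N(S'/S)` of elements of `S` not in the conductor. -/
def sporadicSet (S S' : AddSubmonoid ℕ) : Set ℕ :=
  {a : ℕ | a ∈ S ∧ ∃ t ∈ S', a + t ∉ S}

/-- The pseudo-Frobenius set `PF(S'/S)`. -/
def pseudoFrobSet (S S' : AddSubmonoid ℕ) : Set ℕ :=
  {w : ℕ | w ∈ S' ∧ w ∉ S ∧ ∀ s ∈ S, s ≠ 0 → w + s ∈ S}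

/-- The Frobenius set `F(S'/S)`. -/
def frobSet (S S' : AddSubmonoid ℕ) : Set ℕ :=
  {w : ℕ | w ∈ S' ∧ w ∉ S ∧ ∀ t ∈ S', t ≠ 0 → w + t ∈ S}

/-- `S` is irreducible in `S'`. -/
def IrreducibleIn (S S' : AddSubmonoid ℕ) : Prop :=
  ∀ T₁ T₂ : AddSubmonoid ℕ, S ≤ T₁ → T₁ ≤ S' → S ≤ T₂ → T₂ ≤ S' →
    T₁ ⊓ T₂ = S → T₁ = S ∨ T₂ = S

/-- The fundamental gap set `FG(S'/S)`. -/
def fundGapSet (S S' : AddSubmonoid ℕ) : Set ℕ :=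
  {t : ℕ | t ∈ S' ∧ t ∉ S ∧ 2 * t ∈ S ∧ 3 * t ∈ S}

theorem EquiGcd.setGcd_eq {S S' : AddSubmonoid ℕ} (h : EquiGcd S S') :
    Nat.setGcd (S : Set ℕ) = Nat.setGcd (S' : Set ℕ) := by
  refine Nat.dvd_antisymm ?_ ?_
  · exact Nat.dvd_setGcd_iff.mpr ((h _).mp fun x hx => Nat.setGcd_dvd_of_mem hx)
  · exact Nat.dvd_setGcd_iff.mpr ((h _).mpr fun x hx => Nat.setGcd_dvd_of_mem hx)

theorem AddSubmonoid.exists_forall_ge_mem_of_setGcd_dvd (S : AddSubmonoid ℕ) :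
    ∃ N, ∀ m ≥ N, Nat.setGcd (S : Set ℕ) ∣ m → m ∈ S := by
  simpa using Nat.exists_mem_closure_of_ge (S : Set ℕ)

theorem EquiGcd.finite_gapSet {S S' : AddSubmonoid ℕ} (h : EquiGcd S S') :
    (gapSet S S').Finite := by
  obtain ⟨N, hN⟩ := S.exists_forall_ge_mem_of_setGcd_dvd
  refine (Set.finite_Iio N).subset fun x hx => ?_
  by_contra hxN
  exact hx.2 (hN x (not_lt.mp hxN) (h.setGcd_eq ▸ Nat.setGcd_dvd_of_mem hx.1))

/-- Adjoining the largest gap of `S` in `S'` to `S` gives a submonoid. -/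
def adjoinMaxGap (S S' : AddSubmonoid ℕ) (hSS' : S ≤ S') (F : ℕ) (hF : F ∈ gapSet S S')
    (hmax : ∀ g ∈ gapSet S S', g ≤ F) : AddSubmonoid ℕ where
  carrier := insert F (S : Set ℕ)
  zero_mem' := Or.inr S.zero_mem
  add_mem' := by
    have key : ∀ x ∈ insert F (S : Set ℕ), F + x ∈ insert F (S : Set ℕ) := by
      intro x hx
      rcases Nat.eq_zero_or_pos x with rfl | hx0
      · exact Or.inl rfl
      · refine Or.inr (by_contra fun hn => ?_)
        have hx' : x ∈ S' := hx.elim (fun e => e ▸ hF.1) fun e => hSS' e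
        have := hmax _ ⟨S'.add_mem hF.1 hx', hn⟩
        omega
    rintro a b (rfl | ha) hb
    · exact key b hb
    · rcases hb with rfl | hb
      · exact add_comm a b ▸ key a (Or.inr ha)
      · exact Or.inr (S.add_mem ha hb)

/-- If every monoid between `S` and `S'` is an intersection of radicals, then every gap divides
the largest gap. -/
theorem dvd_max_gap {S S' : AddSubmonoid ℕ} (hSS' : S ≤ S') (hfin : (gapSet S S').Finite)
    (hrad : ∀ T : AddSubmonoid ℕ, S ≤ T → T ≤ S' →
      ∃ A : Set ℕ, (T : Set ℕ) = {t : ℕ | t ∈ S' ∧ ∀ m ∈ A, m * t ∈ S})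
    {F : ℕ} (hF : F ∈ gapSet S S') (hmax : ∀ g ∈ gapSet S S', g ≤ F)
    {g : ℕ} (hg : g ∈ gapSet S S') : g ∣ F := by
  obtain ⟨A, hA⟩ := hrad (adjoinMaxGap S S' hSS' F hF hmax) (fun x hx => Or.inr hx)
    fun x hx => hx.elim (fun e => e ▸ hF.1) fun e => hSS' e
  obtain ⟨u, ⟨hu, hgu⟩, humax⟩ := Set.exists_max_image {u | u ∈ gapSet S S' ∧ g ∣ u} id
    (hfin.subset fun u hu => hu.1) ⟨g, hg, dvd_rfl⟩
  have hu0 : 0 < u := Nat.pos_of_ne_zero fun e => hu.2 (e ▸ S.zero_mem)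
  have hFA : F ∈ {t : ℕ | t ∈ S' ∧ ∀ m ∈ A, m * t ∈ S} := hA ▸ Or.inl rfl
  have huT : u ∈ (adjoinMaxGap S S' hSS' F hF hmax : Set ℕ) := by
    rw [hA]
    refine ⟨hu.1, fun m hm => by_contra fun hn => ?_⟩
    have hle : m * u ≤ u := humax (m * u)
      ⟨⟨nsmul_eq_mul m u ▸ S'.nsmul_mem hu.1 m, hn⟩, hgu.mul_left m⟩
    have hm1 : m ≤ 1 := Nat.le_of_mul_le_mul_right (by simpa using hle) hu0
    interval_cases m
    · exact hn (by simp)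
    · exact hF.2 (by simpa using hFA.2 1 hm)
  rcases huT with rfl | huS
  · exact hgu
  · exact absurd huS hu.2

theorem finitely_many_all_ext_radical (S' : AddSubmonoid ℕ) :
    {S : AddSubmonoid ℕ | S ≤ S' ∧ EquiGcd S S' ∧
      ∀ T : AddSubmonoid ℕ, S ≤ T → T ≤ S' →
        ∃ A : Set ℕ, (T : Set ℕ) = {t : ℕ | t ∈ S' ∧ ∀ m ∈ A, m * t ∈ S}}.Finite := by
  obtain ⟨N, hN⟩ := S'.exists_forall_ge_mem_of_setGcd_dvd
  set d := Nat.setGcd (S' : Set ℕ)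
  have hbound : ∀ S : AddSubmonoid ℕ, S ≤ S' → EquiGcd S S' →
      (∀ T : AddSubmonoid ℕ, S ≤ T → T ≤ S' →
        ∃ A : Set ℕ, (T : Set ℕ) = {t : ℕ | t ∈ S' ∧ ∀ m ∈ A, m * t ∈ S}) →
      ∀ g ∈ gapSet S S', g < d * (3 * N + 7) := by
    intro S hSS' heq hrad g hg
    obtain ⟨F, hF, hmax⟩ := Set.exists_max_image (gapSet S S') id heq.finite_gapSet ⟨g, hg⟩
    refine (hmax g hg).trans_lt ?_
    obtain ⟨f, rfl⟩ : d ∣ F := Nat.setGcd_dvd_of_mem hF.1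
    have hdf : 0 < d * f := Nat.pos_of_ne_zero fun e => hF.2 (e ▸ S.zero_mem)
    have hd0 : 0 < d := Nat.pos_of_mul_pos_right hdf
    refine Nat.mul_lt_mul_of_pos_left (not_le.mp fun hf => ?_) hd0
    have hmem : ∀ y, N ≤ y → ¬ y ∣ f → d * y ∈ S := fun y hy hyf => by_contra fun hn =>
      hyf <| Nat.dvd_of_mul_dvd_mul_left hd0 <| dvd_max_gap hSS' heq.finite_gapSet hrad hF hmax
        ⟨hN _ (hy.trans (Nat.le_mul_of_pos_left y hd0)) (dvd_mul_right d y), hn⟩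
    have hndvd : ∀ k y, k * y < f → f < (k + 1) * y → ¬ y ∣ f := by
      rintro k y h1 h2 ⟨c, rfl⟩
      rw [mul_comm k, mul_comm (k + 1)] at *
      have := Nat.lt_of_mul_lt_mul_left h1
      have := Nat.lt_of_mul_lt_mul_left h2
      omega
    have hsum := S.add_mem
      (hmem (f / 3 + 1) (by omega) (hndvd 2 _ (by omega) (by omega)))
      (hmem (f - (f / 3 + 1)) (by omega) (hndvd 1 _ (by omega) (by omega)))
    rw [← mul_add, Nat.add_sub_cancel' (by omega)] at hsum
    exact hF.2 hsum
  refine Set.Finite.of_finite_image (f := fun S => (S : Set ℕ) ∩ Set.Iio (d * (3 * N + 7)))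
    ((Set.finite_Iio (d * (3 * N + 7))).finite_subsets.subset ?_) ?_
  · rintro _ ⟨S, -, rfl⟩
    exact Set.inter_subset_right
  · have hle : ∀ S₁ S₂ : AddSubmonoid ℕ, S₁ ≤ S' →
        (∀ g ∈ gapSet S₂ S', g < d * (3 * N + 7)) →
        (S₁ : Set ℕ) ∩ Set.Iio (d * (3 * N + 7)) = (S₂ : Set ℕ) ∩ Set.Iio (d * (3 * N + 7)) →
        S₁ ≤ S₂ := fun S₁ S₂ h₁ h₂ h x hx => by_contra fun hn =>
      hn (h ▸ ⟨hx, h₂ x ⟨h₁ hx, hn⟩⟩ : x ∈ (S₂ : Set ℕ) ∩ Set.Iio (d * (3 * N + 7))).1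
    rintro S₁ ⟨h₁, e₁, r₁⟩ S₂ ⟨h₂, e₂, r₂⟩ h
    exact le_antisymm (hle S₁ S₂ h₁ (hbound S₂ h₂ e₂ r₂) h)
      (hle S₂ S₁ h₂ (hbound S₁ h₁ e₁ r₁) h.symm)
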